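/- arXiv:2007.06112 — 2 statements merged into one kernel-verified Lean document; each statement's English description precedes it below -/
import Mathlib

section
/- Let N = 2m and let Γ be the N-by-N block matrix diag(I_m, -I_m). Suppose U is an N-by-N unitary matrix with Γ U Γ = U†. Then there exist an N-by-N unitary matrix Q with Γ Q Γ = Q and an N-by-N matrix D whose four m-by-m blocks D₁₁, D₁₂, D₂₁, D₂₂ are diagonal matrices with real entries, such that U = Q D Q†. -/
/-- Pairwise orthogonal eigenvectors of a symmetric operator, possibly zero, are multiples of
the vectors of an orthonormal eigenbasis. -/
theorem LinearMap.IsSymmetric.exists_orthonormalBasis_of_orthogonal_eigenvectors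
    {𝕜 E ι : Type*} [RCLike 𝕜] [NormedAddCommGroup E] [InnerProductSpace 𝕜 E]
    [FiniteDimensional 𝕜 E] [Fintype ι] {T : E →ₗ[𝕜] E} (hT : T.IsSymmetric)
    (hcard : Module.finrank 𝕜 E = Fintype.card ι) (c : ι → E) (a : ι → ℝ)
    (hc : Pairwise fun i j => inner 𝕜 (c i) (c j) = 0) (hTc : ∀ i, T (c i) = (a i : 𝕜) • c i) :
    ∃ (b : OrthonormalBasis ι 𝕜 E) (μ : ι → ℝ),
      (∀ i, c i = (‖c i‖ : 𝕜) • b i) ∧ ∀ i, T (b i) = (μ i : 𝕜) • b i := by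
  classical
  let K : Submodule 𝕜 E := (Submodule.span 𝕜 (Set.range c))ᗮ
  have hcK (i : ι) (x : E) (hx : x ∈ K) : inner 𝕜 (c i) x = 0 :=
    hx _ (Submodule.subset_span ⟨i, rfl⟩)
  have hK : ∀ x ∈ K, T x ∈ K := by
    intro x hx
    rw [Submodule.mem_orthogonal]
    intro u hu
    induction hu using Submodule.span_induction with
    | mem u hu =>
      obtain ⟨i, rfl⟩ := hu
      rw [← hT, hTc, inner_smul_left, hcK i x hx, mul_zero]
    | zero => simp
    | add u v _ _ hu hv => rw [inner_add_left, hu, hv, add_zero]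
    | smul r u _ hu => rw [inner_smul_left, hu, mul_zero]
  let v : ι → E := fun i => (‖c i‖⁻¹ : 𝕜) • c i
  have hv : Orthonormal 𝕜 fun i : {i // c i ≠ 0} => v i := by
    refine ⟨fun i => ?_, fun i j hij => ?_⟩
    · simpa using norm_smul_inv_norm (𝕜 := 𝕜) i.2
    · simp [v, inner_smul_left, inner_smul_right, hc (Subtype.coe_injective.ne hij)]
  have hspan : Submodule.span 𝕜 (Set.range c) =
      Submodule.span 𝕜 (Set.range fun i : {i // c i ≠ 0} => v i) := by
    apply le_antisymm <;> rw [Submodule.span_le]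
    · rintro _ ⟨i, rfl⟩
      by_cases hi : c i = 0
      · simp [hi]
      · have h : c i = (‖c i‖ : 𝕜) • v i := by simp [v, smul_smul, hi]
        rw [h]
        exact Submodule.smul_mem _ _ (Submodule.subset_span ⟨⟨i, hi⟩, rfl⟩)
    · rintro _ ⟨i, rfl⟩
      exact Submodule.smul_mem _ _ (Submodule.subset_span ⟨_, rfl⟩)
  have hdim : Module.finrank 𝕜 K = Fintype.card {i // ¬ c i ≠ 0} := by
    have h := (Submodule.span 𝕜 (Set.range c)).finrank_add_finrank_orthogonal
    rw [hspan, finrank_span_eq_card hv.linearIndependent, ← hspan, hcard] at h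
    rw [Fintype.card_subtype_compl]
    exact Nat.eq_sub_of_add_eq' h
  let e : {i // ¬ c i ≠ 0} ≃ Fin (Fintype.card {i // ¬ c i ≠ 0}) := Fintype.equivFin _
  let r := ((hT.restrict_invariant hK).eigenvectorBasis hdim).reindex e.symm
  let ν := fun i => (hT.restrict_invariant hK).eigenvalues hdim (e i)
  have hr (i) : T (r i) = (ν i : 𝕜) • (r i : E) := by
    have h := congrArg Subtype.val ((hT.restrict_invariant hK).apply_eigenvectorBasis hdim (e i))
    simpa only [r, ν, OrthonormalBasis.reindex_apply, Equiv.symm_symm,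
      LinearMap.coe_restrict_apply, Submodule.coe_smul] using h
  let w : ι → E := fun i => if h : c i ≠ 0 then v i else r ⟨i, h⟩
  have hw : Orthonormal 𝕜 w := by
    rw [orthonormal_iff_ite]
    intro i j
    have hvr (i : ι) (x : K) : inner 𝕜 (v i) (x : E) = 0 := by
      rw [inner_smul_left, hcK i x x.2, mul_zero]
    by_cases hi : c i ≠ 0 <;> by_cases hj : c j ≠ 0
    · have h := orthonormal_iff_ite.mp hv ⟨i, hi⟩ ⟨j, hj⟩
      simpa only [w, dif_pos hi, dif_pos hj, Subtype.mk.injEq] using h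
    · have hij : i ≠ j := by rintro rfl; exact hj hi
      simp only [w, dif_pos hi, dif_neg hj, if_neg hij, hvr]
    · have hij : i ≠ j := by rintro rfl; exact hi hj
      simp only [w, dif_neg hi, dif_pos hj, if_neg hij]
      rw [inner_eq_zero_symm, hvr]
    · have h := orthonormal_iff_ite.mp r.orthonormal ⟨i, hi⟩ ⟨j, hj⟩
      simpa only [w, dif_neg hi, dif_neg hj, Subtype.mk.injEq, Submodule.coe_inner] using h
  obtain ⟨b, hb⟩ := Orthonormal.exists_orthonormalBasis_extension_of_card_eq hcard
    (v := w) (s := Set.univ) (hw.comp _ Subtype.val_injective)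
  refine ⟨b, fun i => if h : c i ≠ 0 then a i else ν ⟨i, h⟩, fun i => ?_, fun i => ?_⟩
  · by_cases hi : c i = 0
    · simp [hi]
    · rw [hb i trivial]
      simp [w, v, smul_smul, hi]
  · rw [hb i trivial]
    by_cases hi : c i ≠ 0
    · simp only [w, dif_pos hi, v, map_smul, hTc]
      rw [smul_comm]
    · simp only [w, dif_neg hi, hr]

namespace Matrix

variable {n : Type*} [Fintype n] [DecidableEq n]

/-- A Hermitian matrix `E` has a unitary eigenvector matrix `W` adapted to a matrix `C` of
pairwise orthogonal eigenvectors of `E`. -/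
theorem IsHermitian.exists_unitary_of_orthogonal_eigenvectors {E C : Matrix n n ℂ}
    (hE : E.IsHermitian) {a : n → ℝ} (hC : (Cᴴ * C).IsDiag)
    (hEC : E * C = C * diagonal fun i => (a i : ℂ)) :
    ∃ (W : Matrix n n ℂ) (s μ : n → ℝ), Wᴴ * W = 1 ∧
      C = W * (diagonal fun i => (s i : ℂ)) ∧ E * W = W * diagonal fun i => (μ i : ℂ) := by
  let c : n → EuclideanSpace ℂ n := fun j => WithLp.toLp 2 (C.col j)
  have hinner : Pairwise fun i j => inner ℂ (c i) (c j) = 0 := by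
    intro i j hij
    have h : (Cᴴ * C) i j = 0 := hC hij
    rw [mul_apply] at h
    simpa [c, EuclideanSpace.inner_toLp_toLp, dotProduct, mul_comm] using h
  have heig (i : n) : toEuclideanLin E (c i) = (a i : ℂ) • c i := by
    ext k
    have h := congrFun (congrFun hEC k) i
    rw [mul_diagonal, mul_apply] at h
    simpa [c, toLpLin_apply, mulVec, dotProduct, mul_comm] using h
  obtain ⟨b, μ, hb, hμ⟩ :=
    (isSymmetric_toEuclideanLin_iff.mpr hE).exists_orthonormalBasis_of_orthogonal_eigenvectors
      (by simp) c a hinner heig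
  refine ⟨of fun i j => b j i, fun i => ‖c i‖, μ, ?_, ?_, ?_⟩
  · ext i j
    have h := orthonormal_iff_ite.mp b.orthonormal i j
    rw [EuclideanSpace.inner_eq_star_dotProduct] at h
    rw [mul_apply, one_apply, ← h]
    simp [dotProduct, mul_comm]
  · ext k i
    have h := congrArg (fun x : EuclideanSpace ℂ n => x k) (hb i)
    rw [mul_diagonal]
    simpa [c, mul_comm] using h
  · ext k i
    have h := congrArg (fun x : EuclideanSpace ℂ n => x k) (hμ i)
    rw [mul_diagonal, mul_apply]
    simpa [toLpLin_apply, mulVec, dotProduct, mul_comm] using h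

/-- The `2 × 2` Hermitian blocks `A`, `E` and the coupling `B` of a chiral unitary matrix are
simultaneously diagonalised by two unitary matrices. -/
theorem IsHermitian.exists_unitary_diagonalize_blocks {A B E : Matrix n n ℂ}
    (hA : A.IsHermitian) (hE : E.IsHermitian) (hAB : A * B = B * E)
    (hsq : A * A + B * Bᴴ = 1) :
    ∃ (V W : Matrix n n ℂ) (a s μ : n → ℝ), Vᴴ * V = 1 ∧ Wᴴ * W = 1 ∧
      A * V = V * (diagonal fun i => (a i : ℂ)) ∧
      Bᴴ * V = W * (diagonal fun i => (s i : ℂ)) ∧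
      E * W = W * diagonal fun i => (μ i : ℂ) := by
  obtain ⟨V, -, a, hV, -, hAV⟩ :=
    hA.exists_unitary_of_orthogonal_eigenvectors (C := 0) (a := 0) (by simp) (by simp)
  have hBV : ((Bᴴ * V)ᴴ * (Bᴴ * V)).IsDiag := by
    have h : (Bᴴ * V)ᴴ * (Bᴴ * V) = 1 - diagonal (fun i => (a i : ℂ) * a i) := by
      calc (Bᴴ * V)ᴴ * (Bᴴ * V) = Vᴴ * (B * Bᴴ) * V := by
            simp only [conjTranspose_mul, conjTranspose_conjTranspose, Matrix.mul_assoc]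
        _ = Vᴴ * V - Vᴴ * (A * (A * V)) := by
            rw [eq_sub_of_add_eq' hsq]
            noncomm_ring
        _ = _ := by
            rw [hAV, ← Matrix.mul_assoc A, hAV, Matrix.mul_assoc, ← Matrix.mul_assoc Vᴴ, hV,
              Matrix.one_mul, diagonal_mul_diagonal]
    rw [h]
    exact isDiag_one.sub (isDiag_diagonal _)
  have hEB : E * Bᴴ = Bᴴ * A := by
    simpa [conjTranspose_mul, hA.eq, hE.eq] using (congrArg Matrix.conjTranspose hAB).symm
  obtain ⟨W, s, μ, hW, hBW, hEW⟩ :=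
    hE.exists_unitary_of_orthogonal_eigenvectors (C := Bᴴ * V) (a := a) hBV
      (by rw [← Matrix.mul_assoc, hEB, Matrix.mul_assoc, hAV, Matrix.mul_assoc])
  exact ⟨V, W, a, s, μ, hV, hW, hAV, hBW, hEW⟩

end Matrix


open Matrix

/-- The grading `Γ = diag(I_m, -I_m)` on `ℂ^(m ⊕ m)`. -/
noncomputable def Gamma (m : ℕ) : Matrix (Fin m ⊕ Fin m) (Fin m ⊕ Fin m) ℂ :=
  Matrix.fromBlocks 1 0 0 (-1)

/-- A unitary `U` with `Γ U Γ = Uᴴ` can be written as `U = Q D Qᴴ` where `Q`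
is unitary with `Γ Q Γ = Q` and the four `m × m` blocks of `D` are diagonal with real
entries. -/
theorem chiral_unitary_structured_decomposition
    (m : ℕ) (U : Matrix (Fin m ⊕ Fin m) (Fin m ⊕ Fin m) ℂ)
    (hU : Uᴴ * U = 1) (hchiral : Gamma m * U * Gamma m = Uᴴ) :
    ∃ (Q D : Matrix (Fin m ⊕ Fin m) (Fin m ⊕ Fin m) ℂ),
      Qᴴ * Q = 1 ∧ Gamma m * Q * Gamma m = Q ∧
      (∃ d₁₁ d₁₂ d₂₁ d₂₂ : Fin m → ℝ,
        D = Matrix.fromBlocks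
          (Matrix.diagonal fun i => (d₁₁ i : ℂ))
          (Matrix.diagonal fun i => (d₁₂ i : ℂ))
          (Matrix.diagonal fun i => (d₂₁ i : ℂ))
          (Matrix.diagonal fun i => (d₂₂ i : ℂ))) ∧
      U = Q * D * Qᴴ := by
  obtain ⟨A, B, C, E, rfl⟩ : ∃ A B C E, U = fromBlocks A B C E :=
    ⟨_, _, _, _, (fromBlocks_toBlocks U).symm⟩
  simp only [Gamma, fromBlocks_multiply, fromBlocks_conjTranspose, Matrix.one_mul,
    Matrix.zero_mul, Matrix.mul_zero, Matrix.mul_one, add_zero, zero_add, Matrix.neg_mul,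
    Matrix.mul_neg, neg_neg, fromBlocks_inj] at hchiral
  obtain ⟨hA, hB, -, hE⟩ := hchiral
  have hC : C = -Bᴴ := by rw [← conjTranspose_conjTranspose C, ← hB, conjTranspose_neg]
  subst hC
  simp only [fromBlocks_conjTranspose, fromBlocks_multiply, ← hA, ← hE, conjTranspose_neg,
    conjTranspose_conjTranspose, ← fromBlocks_one, fromBlocks_inj, Matrix.neg_mul,
    Matrix.mul_neg, neg_neg] at hU
  obtain ⟨hsq, hAB, -, -⟩ := hU
  obtain ⟨V, W, a, s, μ, hV, hW, hAV, hBV, hEW⟩ :=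
    IsHermitian.exists_unitary_diagonalize_blocks hA.symm hE.symm
      (eq_of_sub_eq_zero (by rw [sub_eq_add_neg, hAB])) hsq
  have hBW : B * W = V * diagonal fun i => (s i : ℂ) := by
    have h : Vᴴ * B = (diagonal fun i => (s i : ℂ)) * Wᴴ := by
      simpa [conjTranspose_mul, diagonal_conjTranspose, Pi.star_def] using
        congrArg conjTranspose hBV
    have hV' : V * Vᴴ = 1 := mul_eq_one_comm.mp hV
    calc B * W = V * (Vᴴ * B) * W := by rw [← Matrix.mul_assoc V, hV', Matrix.one_mul]
      _ = _ := by rw [h, Matrix.mul_assoc, Matrix.mul_assoc, hW, Matrix.mul_one]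
  have hQ : (fromBlocks V 0 0 W)ᴴ * fromBlocks V 0 0 W = 1 := by
    simp [fromBlocks_conjTranspose, fromBlocks_multiply, hV, hW]
  refine ⟨fromBlocks V 0 0 W, _, hQ, by simp [Gamma, fromBlocks_multiply],
    ⟨a, s, fun i => -s i, μ, rfl⟩, ?_⟩
  have hUQ : fromBlocks A B (-Bᴴ) E * fromBlocks V 0 0 W = fromBlocks V 0 0 W * fromBlocks
      (diagonal fun i => (a i : ℂ)) (diagonal fun i => (s i : ℂ))
      (diagonal fun i => ((-s i : ℝ) : ℂ)) (diagonal fun i => (μ i : ℂ)) := by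
    have hneg : (diagonal fun i => ((-s i : ℝ) : ℂ)) = -diagonal fun i => (s i : ℂ) := by
      simp [diagonal_neg]
    rw [hneg]
    simp only [fromBlocks_multiply, Matrix.mul_zero, Matrix.zero_mul, add_zero, zero_add,
      neg_zero, Matrix.neg_mul, Matrix.mul_neg, hAV, hBV, hBW, hEW]
  rw [← hUQ, Matrix.mul_assoc, mul_eq_one_comm.mp hQ, Matrix.mul_one]
end

section
/- Let N = 2m and let Γ be the N-by-N block matrix diag(I_m, -I_m). Suppose U is an N-by-N unitary matrix with Γ U Γ = U†. Then: (a) UΓ is Hermitian and invertible; (b) sig(UΓ) is an even integer; and (c) sig(UΓ) = 0 if and only if the eigenspace E₋₁⁺ = {v : Uv = -v and Γv = v} and the eigenspace E₋₁⁻ = {v : Uv = -v and Γv = -v} have equal dimension. -/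
open Matrix

/-- The signature of a matrix: the number of eigenvalues (roots of the characteristic
polynomial, with multiplicity) with positive real part minus the number with negative real
part.  For an invertible Hermitian matrix this is the usual signature. -/
noncomputable def sig {n : Type*} [Fintype n] [DecidableEq n]
    (X : Matrix n n ℂ) : ℤ :=
  ((X.charpoly.roots.filter fun z => 0 < z.re).card : ℤ) -
    ((X.charpoly.roots.filter fun z => z.re < 0).card : ℤ)

/-- The eigenvalues of an involutive matrix are `1` and `-1`, so its signature is its trace. -/
theorem sig_eq_trace_of_mul_self_eq_one {n : Type*} [Fintype n] [DecidableEq n]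
    {X : Matrix n n ℂ} (hX : X * X = 1) : (sig X : ℂ) = X.trace := by
  have hroots : ∀ z ∈ X.charpoly.roots, z = 1 ∨ z = -1 := by
    intro z hz
    have h1 : z ∈ spectrum ℂ X :=
      Matrix.mem_spectrum_of_isRoot_charpoly (Polynomial.isRoot_of_mem_roots hz)
    cases isEmpty_or_nonempty n with
    | inl _ => simp [Matrix.charpoly, Matrix.det_isEmpty] at hz
    | inr _ =>
      have h2 := spectrum.pow_mem_pow X 2 h1
      rw [sq X, hX, spectrum.one_eq, Set.mem_singleton_iff] at h2
      exact sq_eq_one_iff.mp h2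
  rw [Matrix.trace_eq_sum_roots_charpoly, sig]
  generalize X.charpoly.roots = s at hroots
  induction s using Multiset.induction_on with
  | empty => simp
  | cons a s ih =>
    have ih := ih fun z hz => hroots z (Multiset.mem_cons_of_mem hz)
    push_cast at ih
    rcases hroots a (Multiset.mem_cons_self a s) with rfl | rfl
    · simp [← ih]; ring
    · simp [← ih]; ring

/-- The image of `1 + X` for an involution `X` is the fixed space of `X`. -/
theorem range_toLin'_one_add_of_mul_self_eq_one {n : Type*} [Fintype n] [DecidableEq n]
    {X : Matrix n n ℂ} (hX : X * X = 1) :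
    LinearMap.range (Matrix.toLin' (1 + X)) = Module.End.eigenspace (Matrix.toLin' X) 1 := by
  ext v
  simp only [LinearMap.mem_range, Module.End.mem_eigenspace_iff, Matrix.toLin'_apply, one_smul]
  constructor
  · rintro ⟨w, rfl⟩
    rw [Matrix.mulVec_mulVec, mul_add, hX, mul_one, add_comm]
  · intro h
    refine ⟨(2⁻¹ : ℂ) • v, ?_⟩
    rw [Matrix.mulVec_smul, Matrix.add_mulVec, Matrix.one_mulVec, h, ← two_smul ℂ v, smul_smul]
    norm_num

/-- The kernel of `1 + X` is the `(-1)`-eigenspace of `X`. -/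
theorem ker_toLin'_one_add {n : Type*} [Fintype n] [DecidableEq n] (X : Matrix n n ℂ) :
    LinearMap.ker (Matrix.toLin' (1 + X)) = Module.End.eigenspace (Matrix.toLin' X) (-1) := by
  ext v
  simp [eq_neg_iff_add_eq_zero, add_comm]

/-- The trace of an involution, through the rank of the idempotent `(1 + X) / 2`. -/
theorem trace_eq_two_mul_rank_one_add_sub_card {n : Type*} [Fintype n] [DecidableEq n]
    {X : Matrix n n ℂ} (hX : X * X = 1) :
    X.trace = 2 * ((1 + X).rank : ℂ) - Fintype.card n := by
  set f := Matrix.toLin' ((2⁻¹ : ℂ) • (1 + X)) with hf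
  have hidem : IsIdempotentElem f := by
    have h : (2⁻¹ : ℂ) • (1 + X) * (2⁻¹ : ℂ) • (1 + X) = (2⁻¹ : ℂ) • (1 + X) := by
      rw [smul_mul_smul_comm, add_mul, mul_add, mul_add, hX, one_mul, one_mul, mul_one,
        add_comm X 1, ← two_smul ℂ (1 + X), smul_smul]
      norm_num
    rw [IsIdempotentElem, Module.End.mul_eq_comp, hf, ← Matrix.toLin'_mul, h]
  have htrace := (LinearMap.IsIdempotentElem.isProj_range f hidem).trace
  have hrange : LinearMap.range f = LinearMap.range (Matrix.toLin' (1 + X)) := by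
    rw [hf, map_smul, LinearMap.range_smul _ _ (by norm_num)]
  rw [hrange, hf, Matrix.trace_toLin'_eq, Matrix.trace_smul, Matrix.trace_add,
    Matrix.trace_one, smul_eq_mul] at htrace
  rw [Matrix.rank, ← Matrix.toLin'_apply']
  linear_combination 2 * htrace

/-- Rank–nullity for the restriction of `A` to the image of `B`. -/
theorem rank_mul_add_finrank_inf {n : Type*} [Fintype n] [DecidableEq n] (A B : Matrix n n ℂ) :
    (A * B).rank + Module.finrank ℂ
      ↥(LinearMap.ker (Matrix.toLin' A) ⊓ LinearMap.range (Matrix.toLin' B)) = B.rank := by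
  have h := LinearMap.finrank_range_add_finrank_ker
    ((Matrix.toLin' A).domRestrict (LinearMap.range (Matrix.toLin' B)))
  rw [LinearMap.range_domRestrict, LinearMap.ker_domRestrict, ← LinearMap.range_comp,
    ← Matrix.toLin'_mul] at h
  rw [inf_comm, ← Submodule.map_comap_subtype,
    Submodule.finrank_map_subtype_eq]
  exact h

open scoped ComplexOrder in
theorem rank_mul_comm_of_isHermitian {n : Type*} [Fintype n] [DecidableEq n]
    {A B : Matrix n n ℂ} (hA : A.IsHermitian) (hB : B.IsHermitian) :
    (A * B).rank = (B * A).rank := by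
  rw [← Matrix.rank_conjTranspose, Matrix.conjTranspose_mul, hA.eq, hB.eq]

/-- For a unitary `U` with `Γ U Γ = Uᴴ`: (a) `UΓ` is Hermitian and
invertible; (b) `sig (UΓ)` is even; (c) `sig (UΓ) = 0` iff the spaces
`E₋₁⁺ = {v : Uv = -v, Γv = v}` and `E₋₁⁻ = {v : Uv = -v, Γv = -v}` have equal dimension. -/
theorem chiral_unitary_signature
    (m : ℕ) (U : Matrix (Fin m ⊕ Fin m) (Fin m ⊕ Fin m) ℂ)
    (hU : Uᴴ * U = 1) (hchiral : Gamma m * U * Gamma m = Uᴴ) :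
    (U * Gamma m).IsHermitian ∧ IsUnit (U * Gamma m) ∧
    Even (sig (U * Gamma m)) ∧
    (sig (U * Gamma m) = 0 ↔
      Module.finrank ℂ
        ↥(Module.End.eigenspace (Matrix.toLin' U) (-1) ⊓
            Module.End.eigenspace (Matrix.toLin' (Gamma m)) 1) =
      Module.finrank ℂ
        ↥(Module.End.eigenspace (Matrix.toLin' U) (-1) ⊓
            Module.End.eigenspace (Matrix.toLin' (Gamma m)) (-1))) := by
  have hΓ : Gamma m * Gamma m = 1 := by
    simp [Gamma, Matrix.fromBlocks_multiply]
  have hΓh : (Gamma m)ᴴ = Gamma m := by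
    simp [Gamma, Matrix.fromBlocks_conjTranspose]
  have hUU : U * Uᴴ = 1 := mul_eq_one_comm.mp hU
  have hherm : (U * Gamma m)ᴴ = U * Gamma m := by
    rw [Matrix.conjTranspose_mul, hΓh, ← hchiral, ← mul_assoc, ← mul_assoc, hΓ, one_mul]
  have hsq : U * Gamma m * (U * Gamma m) = 1 := by
    rw [mul_assoc, ← mul_assoc (Gamma m), hchiral, hUU]
  have hsig : sig (U * Gamma m) = 2 * ((1 + U * Gamma m).rank - m : ℤ) := by
    have h := sig_eq_trace_of_mul_self_eq_one hsq
    rw [trace_eq_two_mul_rank_one_add_sub_card hsq, Fintype.card_sum, Fintype.card_fin] at h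
    have h' : (sig (U * Gamma m) : ℂ) = ((2 * ((1 + U * Gamma m).rank - m : ℤ) : ℤ) : ℂ) := by
      rw [h]; push_cast; ring
    exact_mod_cast h'
  have hrank : (1 + Gamma m).rank = m := by
    have h := trace_eq_two_mul_rank_one_add_sub_card hΓ
    have h0 : (Gamma m).trace = 0 := by simp [Gamma, Matrix.trace]
    rw [h0, Fintype.card_sum, Fintype.card_fin] at h
    have h' : (((1 + Gamma m).rank : ℕ) : ℂ) = (m : ℂ) := by
      push_cast at h
      linear_combination -h / 2
    exact_mod_cast h'
  have hplus : Module.End.eigenspace (Matrix.toLin' U) (-1) ⊓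
        Module.End.eigenspace (Matrix.toLin' (Gamma m)) 1 =
      LinearMap.ker (Matrix.toLin' (1 + U * Gamma m)) ⊓
        LinearMap.range (Matrix.toLin' (1 + Gamma m)) := by
    rw [ker_toLin'_one_add, range_toLin'_one_add_of_mul_self_eq_one hΓ]
    ext v
    simp only [Submodule.mem_inf, Module.End.mem_eigenspace_iff, Matrix.toLin'_apply, one_smul]
    refine and_congr_left fun h => ?_
    rw [← Matrix.mulVec_mulVec, h]
  have hminus : Module.End.eigenspace (Matrix.toLin' U) (-1) ⊓
        Module.End.eigenspace (Matrix.toLin' (Gamma m)) (-1) =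
      LinearMap.ker (Matrix.toLin' (1 + Gamma m)) ⊓
        LinearMap.range (Matrix.toLin' (1 + U * Gamma m)) := by
    rw [ker_toLin'_one_add, range_toLin'_one_add_of_mul_self_eq_one hsq, inf_comm]
    ext v
    simp only [Submodule.mem_inf, Module.End.mem_eigenspace_iff, Matrix.toLin'_apply, one_smul,
      neg_smul]
    refine and_congr_right fun h => ?_
    rw [← Matrix.mulVec_mulVec, h, Matrix.mulVec_neg, neg_eq_iff_eq_neg]
  have hadj : ((1 + Gamma m) * (1 + U * Gamma m)).rank =
      ((1 + U * Gamma m) * (1 + Gamma m)).rank :=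
    rank_mul_comm_of_isHermitian (Matrix.isHermitian_one.add hΓh) (Matrix.isHermitian_one.add hherm)
  have hE₁ := rank_mul_add_finrank_inf (1 + U * Gamma m) (1 + Gamma m)
  have hE₂ := rank_mul_add_finrank_inf (1 + Gamma m) (1 + U * Gamma m)
  refine ⟨hherm, IsUnit.of_mul_eq_one _ hsq, hsig ▸ even_two_mul _, ?_⟩
  rw [hplus, hminus, hsig]
  omega
end
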